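/- arXiv:2209.03255 — 4 statements merged into one kernel-verified Lean document; each statement's English description precedes it below -/
import Mathlib

section
/- Let T be a blocktree finset, W a finite set of votes, and b ∈ T. Suppose that for every proper ancestor a ∈ T of b, the child c of a toward b satisfies wt(W, c) > wt(W, c') for every child c' of a in T with c' ≠ c. Then every greedy heaviest chain of (T, W) contains b. -/
/-- `a` is an ancestor of `b` (equivalently, `b` is a descendant of `a`):
`a = parent^[k] b` for some `k ≥ 0`. -/
def Ancestor {B : Type*} (parent : B → B) (a b : B) : Prop :=
  ∃ k : ℕ, a = parent^[k] b

/-- Blocks `a` and `b` conflict if neither is an ancestor of the other. -/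
def Conflicting {B : Type*} (parent : B → B) (a b : B) : Prop :=
  ¬ Ancestor parent a b ∧ ¬ Ancestor parent b a

/-- A finset `T` of blocks is a blocktree finset if it contains the genesis `g`
and is closed under `parent`. -/
def IsBlocktree {B : Type*} (g : B) (parent : B → B) (T : Finset B) : Prop :=
  g ∈ T ∧ ∀ x ∈ T, parent x ∈ T

/-- `c` is a child of `a` in `T`: `c ∈ T`, `c ≠ g`, and `parent c = a`. -/
def IsChild {B : Type*} (g : B) (parent : B → B) (T : Finset B) (a c : B) : Prop :=
  c ∈ T ∧ c ≠ g ∧ parent c = a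

open Classical in
/-- The weight of block `a` w.r.t. the vote set `W`: the number of distinct
validators casting a vote in `W` for a descendant of `a`. -/
noncomputable def wt {B V : Type*} (parent : B → B) (W : Finset (V × B)) (a : B) : ℕ :=
  ((W.filter (fun q => Ancestor parent a q.2)).image Prod.fst).card

/-- `ch 0, ch 1, …, ch k` is a greedy heaviest chain of `(T, W)`:
it starts at the genesis `g`, consists of blocks of `T`, each step goes to a
child of maximal weight, and the endpoint `ch k` has no children in `T`. -/
def IsGreedyChain {B V : Type*} (g : B) (parent : B → B) (T : Finset B)
    (W : Finset (V × B)) (k : ℕ) (ch : ℕ → B) : Prop :=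
  ch 0 = g ∧ (∀ i ≤ k, ch i ∈ T) ∧
  (∀ i < k, IsChild g parent T (ch i) (ch (i + 1)) ∧
      ∀ c', IsChild g parent T (ch i) c' → wt parent W c' ≤ wt parent W (ch (i + 1))) ∧
  ∀ c', ¬ IsChild g parent T (ch k) c'

/-- A blocktree finset contains every ancestor of each of its blocks. -/
lemma IsBlocktree.iterate_mem {B : Type*} {g : B} {parent : B → B} {T : Finset B}
    (hT : IsBlocktree g parent T) {x : B} (hx : x ∈ T) (n : ℕ) : parent^[n] x ∈ T := by
  induction n with
  | zero => exact hx
  | succ n ih =>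
    rw [Function.iterate_succ_apply']
    exact hT.2 _ ih

/-- A proper ancestor `a` of `b ∈ T` has a child in `T` that is an ancestor of `b`. -/
lemma IsBlocktree.exists_isChild_ancestor {B : Type*} {g : B} {parent : B → B} {T : Finset B}
    (hT : IsBlocktree g parent T) (hpg : parent g = g) {a b : B} (hb : b ∈ T)
    (hab : Ancestor parent a b) (hne : a ≠ b) :
    ∃ c, IsChild g parent T a c ∧ Ancestor parent c b := by
  classical
  have ha := Nat.find_spec hab
  have hmin := fun m => Nat.find_min hab (m := m)
  generalize Nat.find hab = n at ha hmin
  cases n with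
  | zero => exact absurd ha hne
  | succ n =>
    rw [Function.iterate_succ_apply'] at ha
    refine ⟨parent^[n] b, ⟨hT.iterate_mem hb n, fun hg => ?_, ha.symm⟩, n, rfl⟩
    exact hmin n n.lt_succ_self (by rw [ha, hg, hpg])

/-- If, along the path from genesis to `b ∈ T`, at every proper
ancestor `a ∈ T` of `b` the child of `a` toward `b` has strictly larger weight
than every other child of `a` in `T`, then every greedy heaviest chain of
`(T, W)` contains `b`. -/
theorem greedy_chain_contains_of_strict_majority_on_path
    {B V : Type*} [DecidableEq B] [DecidableEq V]
    (g : B) (parent : B → B) (hpg : parent g = g) (hanc : ∀ x, Ancestor parent g x)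
    (T : Finset B) (hT : IsBlocktree g parent T)
    (W : Finset (V × B)) (b : B) (hb : b ∈ T)
    (hmaj : ∀ a ∈ T, Ancestor parent a b → a ≠ b →
      ∀ c, IsChild g parent T a c → Ancestor parent c b →
        ∀ c', IsChild g parent T a c' → c' ≠ c →
          wt parent W c' < wt parent W c)
    (k : ℕ) (ch : ℕ → B) (hch : IsGreedyChain g parent T W k ch) :
    ∃ i ≤ k, ch i = b := by
  obtain ⟨h0, hmem, hstep, hend⟩ := hch
  by_contra! hne
  have hpath : ∀ i ≤ k, Ancestor parent (ch i) b := by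
    intro i
    induction i with
    | zero => exact fun _ => h0 ▸ hanc b
    | succ i ih =>
      intro hi
      have hik : i ≤ k := by omega
      obtain ⟨c, hc, hcb⟩ :=
        hT.exists_isChild_ancestor hpg hb (ih hik) (hne i hik)
      obtain ⟨hchild, hmax⟩ := hstep i hi
      have heq : ch (i + 1) = c := by
        by_contra h
        exact (hmax c hc).not_gt
          (hmaj _ (hmem i hik) (ih hik) (hne i hik) c hc hcb _ hchild h)
      exact heq ▸ hcb
  obtain ⟨c, hc, -⟩ :=
    hT.exists_isChild_ancestor hpg hb (hpath k le_rfl) (hne k le_rfl)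
  exact hend c hc
end

section
/- Let T be a blocktree finset, W a finite set of votes, and p ∈ T. Let b ∉ T be a block with parent b = p such that no vote in W is for a descendant of b. If every greedy heaviest chain of (T, W) ends at p, then T ∪ {b} is a blocktree finset and every greedy heaviest chain of (T ∪ {b}, W) ends at b. -/
/-- A block outside a blocktree has no children in the tree obtained by adding it. -/
theorem IsBlocktree.not_isChild_insert {B : Type*} [DecidableEq B] {g : B} {parent : B → B}
    {T : Finset B} (hT : IsBlocktree g parent T) {b : B} (hb : b ∉ T) (hpb : parent b ∈ T)
    (c : B) : ¬ IsChild g parent (insert b T) b c := by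
  rintro ⟨hc, -, hpc⟩
  rcases Finset.mem_insert.1 hc with rfl | hc
  · exact hb (hpc ▸ hpb)
  · exact hb (hpc ▸ hT.2 c hc)

theorem IsChild.mono {B : Type*} {g : B} {parent : B → B} {S T : Finset B} (hST : S ⊆ T)
    {a c : B} (h : IsChild g parent S a c) : IsChild g parent T a c :=
  ⟨hST h.1, h.2⟩

/-- A greedy chain of a larger tree all of whose blocks lie in `S` is a greedy chain of `S`. -/
theorem IsGreedyChain.of_subset {B V : Type*} {g : B} {parent : B → B} {S T : Finset B}
    {W : Finset (V × B)} {k : ℕ} {ch : ℕ → B} (h : IsGreedyChain g parent T W k ch)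
    (hST : S ⊆ T) (hS : ∀ i ≤ k, ch i ∈ S) : IsGreedyChain g parent S W k ch := by
  obtain ⟨h0, -, hstep, hleaf⟩ := h
  refine ⟨h0, hS, fun i hi => ?_, fun c hc => hleaf c (hc.mono hST)⟩
  obtain ⟨hchild, hmax⟩ := hstep i hi
  exact ⟨⟨hS (i + 1) hi, hchild.2⟩, fun c hc => hmax c (hc.mono hST)⟩

/-- If every greedy heaviest chain of `(T, W)` ends at `p ∈ T`,
and `b ∉ T` is a new block with `parent b = p` receiving no votes in `W` (no
vote in `W` is for a descendant of `b`), then `T ∪ {b}` is a blocktree finset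
and every greedy heaviest chain of `(T ∪ {b}, W)` ends at `b`. -/
theorem greedy_chain_ends_at_new_block
    {B V : Type*} [DecidableEq B] [DecidableEq V]
    (g : B) (parent : B → B) (hpg : parent g = g) (hanc : ∀ x, Ancestor parent g x)
    (T : Finset B) (hT : IsBlocktree g parent T)
    (W : Finset (V × B)) (p : B) (hp : p ∈ T)
    (b : B) (hbT : b ∉ T) (hbp : parent b = p)
    (hnovote : ∀ q ∈ W, ¬ Ancestor parent b q.2)
    (hend : ∀ k ch, IsGreedyChain g parent T W k ch → ch k = p) :
    IsBlocktree g parent (insert b T) ∧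
      ∀ k ch, IsGreedyChain g parent (insert b T) W k ch → ch k = b := by
  have hpT : parent b ∈ T := hbp ▸ hp
  refine ⟨⟨Finset.mem_insert_of_mem hT.1, fun x hx => ?_⟩, fun k ch hch => ?_⟩
  · rcases Finset.mem_insert.1 hx with rfl | hx
    · exact Finset.mem_insert_of_mem hpT
    · exact Finset.mem_insert_of_mem (hT.2 x hx)
  · by_contra hk
    have hmem : ∀ i ≤ k, ch i ∈ T := by
      intro i hi
      refine Finset.mem_of_mem_insert_of_ne (hch.2.1 i hi) fun hib => ?_
      have hlt : i < k := lt_of_le_of_ne hi fun hik => hk (hik ▸ hib)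
      exact hT.not_isChild_insert hbT hpT _ (hib ▸ (hch.2.2.1 i hlt).1)
    have hkp := hend k ch (hch.of_subset (Finset.subset_insert b T) hmem)
    exact hch.2.2.2 b ⟨Finset.mem_insert_self b T, fun hbg => hbT (hbg ▸ hT.1), hbp.trans hkp.symm⟩
end

section
/- Let ε > 0 and M > 0 be real numbers, E a finset of validators with |E| ≤ (1+ε)·M, and W a finite set of votes all of whose validators lie in E. Suppose b₁ and b₂ are two distinct blocks such that for each i ∈ {1, 2}, the number of distinct validators v with (v, b_i) ∈ W is at least (3/4+ε)·M. Then the number of equivocators in W is at least (1/2+ε)·M. -/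
open Classical in
/-- The equivocators in a vote set `W`: validators with votes in `W` for two
different blocks. -/
noncomputable def Equivocators {B V : Type*} (W : Finset (V × B)) : Finset V :=
  (W.image Prod.fst).filter (fun v => ∃ c c', (v, c) ∈ W ∧ (v, c') ∈ W ∧ c ≠ c')

/-- If all validators of `W` lie in a committee `E` with
`|E| ≤ (1+ε)M`, and two distinct blocks `b₁ ≠ b₂` each receive votes in `W`
from at least `(3/4+ε)M` distinct validators, then at least `(1/2+ε)M`
validators equivocate in `W`. -/
theorem equivocators_of_two_fast_confirmed
    {B V : Type*} [DecidableEq B] [DecidableEq V]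
    (ε M : ℝ) (hε : 0 < ε) (hM : 0 < M)
    (E : Finset V) (hE : (E.card : ℝ) ≤ (1 + ε) * M)
    (W : Finset (V × B)) (hWE : ∀ q ∈ W, q.1 ∈ E)
    (b₁ b₂ : B) (hne : b₁ ≠ b₂)
    (h1 : (3 / 4 + ε) * M ≤ (((W.filter (fun q => q.2 = b₁)).image Prod.fst).card : ℝ))
    (h2 : (3 / 4 + ε) * M ≤ (((W.filter (fun q => q.2 = b₂)).image Prod.fst).card : ℝ)) :
    (1 / 2 + ε) * M ≤ ((Equivocators W).card : ℝ) := by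
  set A₁ := (W.filter (fun q => q.2 = b₁)).image Prod.fst
  set A₂ := (W.filter (fun q => q.2 = b₂)).image Prod.fst
  have mem_votes {b : B} {v : V}
      (h : v ∈ (W.filter (fun q => q.2 = b)).image Prod.fst) : (v, b) ∈ W := by
    obtain ⟨⟨v', c⟩, hq, rfl⟩ := Finset.mem_image.mp h
    obtain ⟨hW, rfl⟩ := Finset.mem_filter.mp hq
    exact hW
  have union_subset : A₁ ∪ A₂ ⊆ E := by
    intro v hv
    rcases Finset.mem_union.mp hv with h | h
    · exact hWE _ (mem_votes h)
    · exact hWE _ (mem_votes h)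
  have inter_subset : A₁ ∩ A₂ ⊆ Equivocators W := by
    intro v hv
    obtain ⟨hv₁, hv₂⟩ := Finset.mem_inter.mp hv
    simp only [Equivocators, Finset.mem_filter, Finset.mem_image]
    exact ⟨⟨_, mem_votes hv₁, rfl⟩, b₁, b₂, mem_votes hv₁, mem_votes hv₂, hne⟩
  have union_le : ((A₁ ∪ A₂).card : ℝ) ≤ E.card :=
    mod_cast Finset.card_le_card union_subset
  have inter_le : ((A₁ ∩ A₂).card : ℝ) ≤ (Equivocators W).card :=
    mod_cast Finset.card_le_card inter_subset
  have card_add : ((A₁ ∪ A₂).card : ℝ) + (A₁ ∩ A₂).card = A₁.card + A₂.card :=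
    mod_cast Finset.card_union_add_card_inter A₁ A₂
  linarith
end

section
/- (Symmetry of VRF-based leader election.) Let ι be a nonempty finite type and let μ be the product probability measure on ι → ℝ whose factors are all equal to the uniform probability measure on the interval [0,1]. For every finset S of ι, the μ-measure of the set {x : ι → ℝ | ∃ i ∈ S, ∀ j ≠ i, x i < x j} (the event that the unique minimum of the coordinates is attained at an index in S) equals |S| / |ι|. -/
open MeasureTheory

/-- The event that the unique minimum coordinate is attained at `i`. -/
def strictMinAt {ι : Type*} (i : ι) : Set (ι → ℝ) := {x | ∀ j ≠ i, x i < x j}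

lemma measurableSet_strictMinAt {ι : Type*} [Finite ι] (i : ι) :
    MeasurableSet (strictMinAt i) := by
  have h : strictMinAt i = ⋂ j, ⋂ _ : j ≠ i, {x : ι → ℝ | x i < x j} := by
    ext x
    simp [strictMinAt]
  rw [h]
  exact .iInter fun j => .iInter fun _ =>
    measurableSet_lt (measurable_pi_apply i) (measurable_pi_apply j)

lemma pairwise_disjoint_strictMinAt (ι : Type*) :
    Pairwise (Function.onFun Disjoint (strictMinAt (ι := ι))) := fun i j hij =>
  Set.disjoint_left.2 fun _ hi hj => lt_asymm (hi j hij.symm) (hj i hij)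

/-- Coordinates of almost every point are pairwise distinct. -/
lemma ae_injective_volume_pi (ι : Type*) [Fintype ι] :
    ∀ᵐ x : ι → ℝ, Function.Injective x := by
  have h : ∀ i j : ι, ∀ᵐ x : ι → ℝ, x i = x j → i = j := by
    intro i j
    rcases eq_or_ne i j with rfl | hij
    · simp
    let φ : (ι → ℝ) →ₗ[ℝ] ℝ :=
      LinearMap.proj (R := ℝ) (φ := fun _ => ℝ) i - LinearMap.proj (R := ℝ) (φ := fun _ => ℝ) j
    have hφ : LinearMap.ker φ ≠ ⊤ := by
      classical
      intro h
      have h1 : Pi.single i (1 : ℝ) ∈ LinearMap.ker φ := h ▸ Submodule.mem_top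
      simp [φ, hij.symm] at h1
    refine measure_mono_null (fun x hx => ?_) (Measure.addHaar_submodule volume _ hφ)
    simp only [Set.mem_compl_iff, Set.mem_ofPred_eq, Classical.not_imp] at hx
    simp [φ, hx.1]
  filter_upwards [ae_all_iff.2 fun i => ae_all_iff.2 (h i)] with x hx i j using hx i j

lemma Function.Injective.exists_mem_strictMinAt {ι : Type*} [Finite ι] [Nonempty ι] {x : ι → ℝ}
    (hx : Function.Injective x) : ∃ i, x ∈ strictMinAt i := by
  obtain ⟨i, hi⟩ := Finite.exists_min x
  exact ⟨i, fun j hj => (hi j).lt_of_ne (hx.ne hj.symm)⟩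

/-- Under a product of identical measures, all indices are equally likely to attain the minimum. -/
lemma pi_strictMinAt_eq {ι : Type*} [Fintype ι] (μ : Measure ℝ) [SigmaFinite μ] (i k : ι) :
    Measure.pi (fun _ : ι => μ) (strictMinAt i) = Measure.pi (fun _ : ι => μ) (strictMinAt k) := by
  classical
  have h := measurePreserving_piCongrLeft (fun _ : ι => μ) (Equiv.swap i k)
  rw [← h.measure_preimage (measurableSet_strictMinAt k).nullMeasurableSet]
  congr 1
  ext x
  have hx (j : ι) : MeasurableEquiv.piCongrLeft (fun _ => ℝ) (Equiv.swap i k) x j =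
      x (Equiv.swap i k j) := by
    obtain ⟨j, rfl⟩ := (Equiv.swap i k).surjective j
    rw [MeasurableEquiv.piCongrLeft_apply_apply, Equiv.swap_apply_self]
  simp only [strictMinAt, Set.mem_ofPred_eq, Set.mem_preimage, hx, Equiv.swap_apply_right]
  rw [← (Equiv.swap i k).forall_congr_right]
  refine forall_congr' fun j => ?_
  rw [ne_eq, ne_eq, Equiv.swap_apply_eq_iff, Equiv.swap_apply_left]

/-- **Symmetry of VRF-based leader election.** For a nonempty
finite index type `ι` and the product of uniform measures on `[0,1]`, the
probability that the unique minimum coordinate is attained at an index in a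
finset `S` equals `|S| / |ι|`. -/
theorem leader_election_symmetry
    (ι : Type*) [Fintype ι] [Nonempty ι] (S : Finset ι) :
    Measure.pi (fun _ : ι => volume.restrict (Set.Icc (0 : ℝ) 1))
        {x : ι → ℝ | ∃ i ∈ S, ∀ j ≠ i, x i < x j} =
      (S.card : ENNReal) / (Fintype.card ι : ENNReal) := by
  have : IsProbabilityMeasure (volume.restrict (Set.Icc (0 : ℝ) 1)) := ⟨by simp⟩
  set P := Measure.pi (fun _ : ι => volume.restrict (Set.Icc (0 : ℝ) 1)) with hP
  obtain ⟨i₀⟩ := ‹Nonempty ι›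
  have key (T : Finset ι) : P (⋃ i ∈ T, strictMinAt i) = T.card * P (strictMinAt i₀) := by
    rw [measure_biUnion_finset (fun i _ j _ hij => pairwise_disjoint_strictMinAt ι hij)
      fun i _ => measurableSet_strictMinAt i,
      Finset.sum_congr rfl fun i _ => pi_strictMinAt_eq _ i i₀]
    simp [P]
  have inj : ∀ᵐ x ∂P, Function.Injective x := by
    rw [hP, ← Measure.restrict_pi_pi, ← volume_pi]
    exact ae_restrict_of_ae (ae_injective_volume_pi ι)
  have total : (Fintype.card ι : ENNReal) * P (strictMinAt i₀) = 1 := by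
    rw [← Finset.card_univ, ← key, ← measure_univ (μ := P)]
    refine measure_congr (Filter.eventuallyEq_set.2 ?_)
    have : Nonempty ι := ⟨i₀⟩
    filter_upwards [inj] with x hx
    simpa using hx.exists_mem_strictMinAt
  have hS : {x : ι → ℝ | ∃ i ∈ S, ∀ j ≠ i, x i < x j} = ⋃ i ∈ S, strictMinAt i := by
    ext x
    simp [strictMinAt]
  rw [hS, key, div_eq_mul_inv, ENNReal.eq_inv_of_mul_eq_one_left ((mul_comm _ _).trans total)]
end
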